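/- Equivalence of the risk-averse HJB QVI and its exponential-ansatz reduction: Let ψ > 0 and let v : [0,T] × Q × ℝ → ℝ be such that for each y ∈ Q the map (t,S) ↦ v(t,y,S) is continuously differentiable in t on [0,T) and twice continuously differentiable in S on ℝ. Define u(t,y,S,p) = −exp{−ψ(p + v(t,y,S))}. Then for every (t,y,S,p) ∈ [0,T) × Q × ℝ × ℝ, the equality 0 = min{ −∂_t u(t,y,S,p) − ½σ²∂²_{SS} u(t,y,S,p) − 1_{{y+ξ ≤ Ȳ}} λ̄^b(y,S)[u(t, y+ξ, S, p+β^b(y,S)) − u(t,y,S,p)] − 1_{{y−ξ ≥ Y̲}} λ̄^a(y,S)[u(t, y−ξ, S, p+β^a(y,S)) − u(t,y,S,p)], u(t,y,S,p) + e^{−ψp} } holds if and only if 0 = min{ −∂_t v(t,y,S) − ½σ²( ∂²_{SS} v(t,y,S) − ψ(∂_S v(t,y,S))² ) − 1_{{y+ξ ≤ Ȳ}} λ̄^b(y,S)·(1/ψ)[1 − exp{−ψ(β^b(y,S) + v(t,y+ξ,S) − v(t,y,S))}] − 1_{{y−ξ ≥ Y̲}} λ̄^a(y,S)·(1/ψ)[1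 − exp{−ψ(β^a(y,S) + v(t,y−ξ,S) − v(t,y,S))}], v(t,y,S) }. -/

import Mathlib

open Set Filter MeasureTheory

noncomputable section

/-- The inventory grid `Q = {Y̲, Y̲+ξ, …, Ȳ}`. -/
def Qset (ξ Ylo Yhi : ℝ) : Set ℝ := {y | (∃ k : ℕ, y = Ylo + k * ξ) ∧ y ≤ Yhi}

/-- Buy-side intensity `λ̄ᵇ(y,S) = max{a₀, a₁ + a₂(c/y² − S)}`. -/
def lamB (c a0 a1 a2 y S : ℝ) : ℝ := max a0 (a1 + a2 * (c / y ^ 2 - S))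

/-- Sell-side intensity `λ̄ᵃ(y,S) = max{a₀, a₁ + a₂(S − c/y²)}`. -/
def lamA (c a0 a1 a2 y S : ℝ) : ℝ := max a0 (a1 + a2 * (S - c / y ^ 2))

/-- Buy-side payoff `βᵇ(y,S) = φ_c(y+ξ) − φ_c(y) + ξS + 𝔯(y)`, with `φ_c(y) = c/y`. -/
def betaB (c ξ : ℝ) (fee : ℝ → ℝ) (y S : ℝ) : ℝ := c / (y + ξ) - c / y + ξ * S + fee y

/-- Sell-side payoff `βᵃ(y,S) = φ_c(y−ξ) − φ_c(y) − ξS + 𝔯(y)`, with `φ_c(y) = c/y`. -/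
def betaA (c ξ : ℝ) (fee : ℝ → ℝ) (y S : ℝ) : ℝ := c / (y - ξ) - c / y - ξ * S + fee y

/-- The exponential ansatz `u(t,y,S,p) = −exp{−ψ(p + v(t,y,S))}`. -/
def uAnsatz (ψ : ℝ) (v : ℝ → ℝ → ℝ → ℝ) (t y S p : ℝ) : ℝ :=
  -Real.exp (-ψ * (p + v t y S))

/-- Whether a minimum vanishes depends only on the signs of its two entries. -/
lemma zero_eq_min_congr {a b a' b' : ℝ} (ha : 0 ≤ a ↔ 0 ≤ a') (ha0 : a = 0 ↔ a' = 0)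
    (hb : 0 ≤ b ↔ 0 ≤ b') (hb0 : b = 0 ↔ b' = 0) :
    (0 : ℝ) = min a b ↔ (0 : ℝ) = min a' b' := by
  rw [eq_comm, eq_comm (a := (0 : ℝ)), min_eq_iff, min_eq_iff]
  constructor <;> rintro (⟨h, h'⟩ | ⟨h, h'⟩)
  · exact Or.inl ⟨ha0.1 h, by rw [ha0.1 h]; exact hb.1 (h ▸ h')⟩
  · exact Or.inr ⟨hb0.1 h, by rw [hb0.1 h]; exact ha.1 (h ▸ h')⟩
  · exact Or.inl ⟨ha0.2 h, by rw [ha0.2 h]; exact hb.2 (h ▸ h')⟩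
  · exact Or.inr ⟨hb0.2 h, by rw [hb0.2 h]; exact ha.2 (h ▸ h')⟩

lemma derivWithin_neg_exp_neg_mul_add {f : ℝ → ℝ} {s : Set ℝ} {t : ℝ} (ψ p : ℝ)
    (hf : DifferentiableWithinAt ℝ f s t) (hs : UniqueDiffWithinAt ℝ s t) :
    derivWithin (fun x => -Real.exp (-ψ * (p + f x))) s t
      = ψ * Real.exp (-ψ * (p + f t)) * derivWithin f s t := by
  have h := (((hf.hasDerivWithinAt.const_add p).const_mul (-ψ)).exp).neg
  refine (h.derivWithin hs).trans ?_
  ring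

lemma deriv_deriv_neg_exp_neg_mul_add {f : ℝ → ℝ} (hf : ContDiff ℝ 2 f) (ψ p x : ℝ) :
    deriv (deriv fun r => -Real.exp (-ψ * (p + f r))) x
      = ψ * Real.exp (-ψ * (p + f x)) * (deriv (deriv f) x - ψ * deriv f x ^ 2) := by
  have hf1 : Differentiable ℝ f := hf.differentiable (by norm_num)
  have hf2 : Differentiable ℝ (deriv f) := by
    have h : ContDiff ℝ (1 + 1) f := by rwa [one_add_one_eq_two]
    exact (contDiff_succ_iff_deriv.1 h).2.2.differentiable (by norm_num)
  have hexp (r : ℝ) : HasDerivAt (fun r => Real.exp (-ψ * (p + f r)))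
      (Real.exp (-ψ * (p + f r)) * (-ψ * deriv f r)) r :=
    (((hf1 r).hasDerivAt.const_add p).const_mul (-ψ)).exp
  have h1 : deriv (fun r => -Real.exp (-ψ * (p + f r)))
      = fun r => ψ * (Real.exp (-ψ * (p + f r)) * deriv f r) := by
    funext r
    refine (hexp r).neg.deriv.trans ?_
    ring
  rw [h1]
  refine (((hexp x).mul (hf2 x).hasDerivAt).const_mul ψ).deriv.trans ?_
  ring

/-- The jump of `u` factorizes through the jump of `v`. -/
lemma uAnsatz_sub_uAnsatz (ψ : ℝ) (v : ℝ → ℝ → ℝ → ℝ) (t y y' S p b : ℝ) :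
    uAnsatz ψ v t y' S (p + b) - uAnsatz ψ v t y S p
      = Real.exp (-ψ * (p + v t y S))
        * (1 - Real.exp (-ψ * (b + v t y' S - v t y S))) := by
  have h : Real.exp (-ψ * (p + b + v t y' S))
      = Real.exp (-ψ * (p + v t y S)) * Real.exp (-ψ * (b + v t y' S - v t y S)) := by
    rw [← Real.exp_add]
    ring_nf
  simp only [uAnsatz, h]
  ring

/-- **Equivalence of the risk-averse HJB QVI and its exponential-ansatz reduction.**
For `ψ > 0` and `v` smooth enough (C¹ in `t` on `[0,T)` and C² in `S`), setting
`u(t,y,S,p) = −exp{−ψ(p + v(t,y,S))}`, the risk-averse HJB QVI for `u` holds at a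
point of `[0,T) × Q × ℝ × ℝ` if and only if the reduced HJB QVI for `v` holds at the
corresponding point. -/
theorem risk_averse_ansatz_equivalence
    (T c ξ Ylo Yhi σ a0 a1 a2 : ℝ) (fee : ℝ → ℝ)
    (hT : 0 < T) (hc : 0 < c) (hξ : 0 < ξ)
    (hYlo : 0 < Ylo) (hYY : Ylo < Yhi)
    (hmul : ∃ m n : ℕ, Ylo = m * ξ ∧ Yhi = n * ξ)
    (ha0 : 0 < a0) (ha1 : 0 ≤ a1) (ha2 : 0 ≤ a2)
    (hσ : 0 < σ)
    (hfee_pos : ∀ y : ℝ, 0 ≤ y → 0 ≤ fee y)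
    (hfee_growth : ∃ K : ℝ, ∀ y : ℝ, 0 ≤ y → fee y ≤ K * (1 + y))
    (ψ : ℝ) (hψ : 0 < ψ)
    (v : ℝ → ℝ → ℝ → ℝ)
    (hv_t : ∀ y ∈ Qset ξ Ylo Yhi, ∀ S : ℝ,
      ContDiffOn ℝ 1 (fun t => v t y S) (Set.Ico 0 T))
    (hv_S : ∀ t ∈ Set.Icc (0 : ℝ) T, ∀ y ∈ Qset ξ Ylo Yhi,
      ContDiff ℝ 2 (fun S => v t y S)) :
    ∀ t ∈ Set.Ico (0 : ℝ) T, ∀ y ∈ Qset ξ Ylo Yhi, ∀ S p : ℝ,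
      ((0 : ℝ) = min
        (-(derivWithin (fun s => uAnsatz ψ v s y S p) (Set.Ico 0 T) t)
          - (1 / 2) * σ ^ 2 * deriv (deriv (fun r => uAnsatz ψ v t y r p)) S
          - (if y + ξ ≤ Yhi then (1 : ℝ) else 0) * lamB c a0 a1 a2 y S *
              (uAnsatz ψ v t (y + ξ) S (p + betaB c ξ fee y S) - uAnsatz ψ v t y S p)
          - (if Ylo ≤ y - ξ then (1 : ℝ) else 0) * lamA c a0 a1 a2 y S *
              (uAnsatz ψ v t (y - ξ) S (p + betaA c ξ fee y S) - uAnsatz ψ v t y S p))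
        (uAnsatz ψ v t y S p + Real.exp (-ψ * p)))
      ↔
      ((0 : ℝ) = min
        (-(derivWithin (fun s => v s y S) (Set.Ico 0 T) t)
          - (1 / 2) * σ ^ 2 *
              (deriv (deriv (fun r => v t y r)) S - ψ * (deriv (fun r => v t y r) S) ^ 2)
          - (if y + ξ ≤ Yhi then (1 : ℝ) else 0) * lamB c a0 a1 a2 y S * (1 / ψ) *
              (1 - Real.exp (-ψ * (betaB c ξ fee y S + v t (y + ξ) S - v t y S)))
          - (if Ylo ≤ y - ξ then (1 : ℝ) else 0) * lamA c a0 a1 a2 y S * (1 / ψ) *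
              (1 - Real.exp (-ψ * (betaA c ξ fee y S + v t (y - ξ) S - v t y S))))
        (v t y S)) := by
  intro t ht y hy S p
  have hE : 0 < ψ * Real.exp (-ψ * (p + v t y S)) := mul_pos hψ (Real.exp_pos _)
  have hdt := derivWithin_neg_exp_neg_mul_add ψ p
    ((hv_t y hy S).differentiableOn one_ne_zero t ht) (uniqueDiffOn_Ico 0 T t ht)
  have hdS := deriv_deriv_neg_exp_neg_mul_add (hv_S t (Ico_subset_Icc_self ht) y hy) ψ p S
  rw [uAnsatz_sub_uAnsatz, uAnsatz_sub_uAnsatz]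
  simp only [uAnsatz]
  rw [hdt, hdS]
  have hfactor (D L B A x z : ℝ) :
      -(ψ * Real.exp (-ψ * (p + v t y S)) * D)
        - 1 / 2 * σ ^ 2 * (ψ * Real.exp (-ψ * (p + v t y S)) * L)
        - B * (Real.exp (-ψ * (p + v t y S)) * x) - A * (Real.exp (-ψ * (p + v t y S)) * z)
      = ψ * Real.exp (-ψ * (p + v t y S))
        * (-D - 1 / 2 * σ ^ 2 * L - B * (1 / ψ) * x - A * (1 / ψ) * z) := by
    field_simp
  rw [hfactor]
  refine zero_eq_min_congr (mul_nonneg_iff_of_pos_left hE) (mul_eq_zero_iff_left hE.ne') ?_ ?_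
  · rw [neg_add_eq_sub, sub_nonneg, Real.exp_le_exp, neg_mul, neg_mul, neg_le_neg_iff,
      mul_le_mul_iff_right₀ hψ, le_add_iff_nonneg_right]
  · rw [neg_add_eq_zero, Real.exp_eq_exp, mul_right_inj' (neg_ne_zero.2 hψ.ne'), add_eq_left]
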